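/- The five-fold convolution μ = σ ∗ σ ∗ σ ∗ σ ∗ σ of the arc-length measure on the unit circle is absolutely continuous with a density that is essentially bounded on the ball {x ∈ ℝ² : |x| ≤ 5}: there exists C > 0 with ‖μ‖_{L^∞({|x|≤5})} ≤ C. -/

import Mathlib

open MeasureTheory Real
open scoped ENNReal
noncomputable section

abbrev E2 : Type := EuclideanSpace ℝ (Fin 2)

/-- Arc-length measure on the unit circle. -/
def sm : Measure E2 := (μH[1]).restrict (Metric.sphere (0 : E2) 1)

/-- Convolution of measures on `ℝ²`. -/
def mconv (μ ν : Measure E2) : Measure E2 := (μ.prod ν).map (fun p => p.1 + p.2)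


/-- The oscillating phase. -/
def ph (R θ : ℝ) : ℂ := Complex.exp ((R * Real.cos θ : ℝ) * Complex.I)

lemma ph_norm (R θ : ℝ) : ‖ph R θ‖ = 1 := by
  unfold ph; exact Complex.norm_exp_ofReal_mul_I _

lemma ph_cont (R : ℝ) : Continuous (ph R) := by
  unfold ph; fun_prop

lemma vdc1 (R δ : ℝ) (hR : R ≠ 0) (hδ : 0 < δ) (hδ' : δ ≤ π / 2) :
    ‖∫ θ in δ..(π/2), ph R θ‖ ≤ π / (|R| * δ) := by
  have hpi := Real.pi_pos
  have hsin : ∀ θ ∈ Set.uIcc δ (π/2), 0 < Real.sin θ := by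
    intro θ hθ
    rw [Set.uIcc_of_le hδ'] at hθ
    exact Real.sin_pos_of_pos_of_lt_pi (by linarith [hθ.1]) (by linarith [hθ.2])
  have hsinδ : 0 < Real.sin δ := hsin δ Set.left_mem_uIcc
  have hG : ∀ θ ∈ Set.uIcc δ (π/2), HasDerivAt (fun θ => -(Real.sin θ)⁻¹)
      (Real.cos θ / (Real.sin θ)^2) θ := by
    intro θ hθ
    have := ((Real.hasDerivAt_sin θ).inv (hsin θ hθ).ne').neg
    exact this.congr_deriv (by ring)
  have hGc : ContinuousOn (fun θ => Real.cos θ / (Real.sin θ)^2) (Set.uIcc δ (π/2)) := by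
    apply ContinuousOn.div (by fun_prop) (by fun_prop)
    intro θ hθ
    exact pow_ne_zero _ (hsin θ hθ).ne'
  have hGi : IntervalIntegrable (fun θ => Real.cos θ / (Real.sin θ)^2) volume δ (π/2) :=
    hGc.intervalIntegrable
  have hGint : ∫ θ in δ..(π/2), Real.cos θ / (Real.sin θ)^2 = (Real.sin δ)⁻¹ - 1 := by
    rw [intervalIntegral.integral_eq_sub_of_hasDerivAt hG hGi]
    simp; ring
  have hph : ∀ θ, HasDerivAt (ph R) (ph R θ * ((-(R * Real.sin θ) : ℝ) * Complex.I)) θ := by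
    intro θ
    have h1 : HasDerivAt (fun θ : ℝ => R * Real.cos θ) (-(R * Real.sin θ)) θ := by
      exact ((Real.hasDerivAt_cos θ).const_mul R).congr_deriv (by ring)
    exact (h1.ofReal_comp.mul_const Complex.I).cexp
  have hF : ∀ θ ∈ Set.uIcc δ (π/2), HasDerivAt (fun θ => ((-(Real.sin θ)⁻¹ : ℝ) : ℂ) * ph R θ)
      (((Real.cos θ / (Real.sin θ)^2 : ℝ) : ℂ) * ph R θ + (R * Complex.I) * ph R θ) θ := by
    intro θ hθ
    have := (hG θ hθ).ofReal_comp.mul (hph θ)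
    refine this.congr_deriv ?_
    have hne : (Real.sin θ : ℂ) ≠ 0 := by exact_mod_cast (hsin θ hθ).ne'
    push_cast at hne ⊢
    field_simp
  have hi1 : IntervalIntegrable (fun θ => ((Real.cos θ / (Real.sin θ)^2 : ℝ) : ℂ) * ph R θ)
      volume δ (π/2) := by
    apply ContinuousOn.intervalIntegrable
    exact (Complex.continuous_ofReal.comp_continuousOn hGc).mul (ph_cont R).continuousOn
  have hi2 : IntervalIntegrable (fun θ => (R * Complex.I) * ph R θ) volume δ (π/2) :=
    (continuous_const.mul (ph_cont R)).intervalIntegrable _ _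
  have hFTC := intervalIntegral.integral_eq_sub_of_hasDerivAt hF (hi1.add hi2)
  rw [intervalIntegral.integral_add hi1 hi2, intervalIntegral.integral_const_mul] at hFTC
  have hb1 : ‖∫ θ in δ..(π/2), ((Real.cos θ / (Real.sin θ)^2 : ℝ) : ℂ) * ph R θ‖
      ≤ (Real.sin δ)⁻¹ - 1 := by
    rw [← hGint]
    apply intervalIntegral.norm_integral_le_of_norm_le hδ' _ hGi
    refine Filter.Eventually.of_forall fun θ hθ => ?_
    rw [norm_mul, ph_norm, mul_one, Complex.norm_real, Real.norm_eq_abs, abs_of_nonneg]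
    apply div_nonneg (Real.cos_nonneg_of_mem_Icc ⟨by linarith [hθ.1], hθ.2⟩) (sq_nonneg _)
  have hsplit : (R * Complex.I) * ∫ θ in δ..(π/2), ph R θ =
      ((-(Real.sin (π/2))⁻¹ : ℝ) : ℂ) * ph R (π/2) - ((-(Real.sin δ)⁻¹ : ℝ) : ℂ) * ph R δ
      - ∫ θ in δ..(π/2), ((Real.cos θ / (Real.sin θ)^2 : ℝ) : ℂ) * ph R θ := by
    rw [← hFTC]; ring
  have hn : |R| * ‖∫ θ in δ..(π/2), ph R θ‖ ≤ 2 * (Real.sin δ)⁻¹ := by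
    have h2 : |R| * ‖∫ θ in δ..(π/2), ph R θ‖ = ‖(R * Complex.I) * ∫ θ in δ..(π/2), ph R θ‖ := by
      simp
    rw [h2, hsplit]
    refine (norm_sub_le _ _).trans ?_
    have h3 : ‖((-(Real.sin (π/2))⁻¹ : ℝ) : ℂ) * ph R (π/2) - ((-(Real.sin δ)⁻¹ : ℝ) : ℂ) * ph R δ‖
        ≤ 1 + (Real.sin δ)⁻¹ := by
      refine (norm_sub_le _ _).trans ?_
      rw [norm_mul, norm_mul, ph_norm, ph_norm, Complex.norm_real, Complex.norm_real]
      simp [abs_of_pos hsinδ]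
    linarith
  have hsl := Real.mul_le_sin hδ.le hδ'
  have hRp : 0 < |R| := abs_pos.mpr hR
  have h4 : (Real.sin δ)⁻¹ ≤ (2 / π * δ)⁻¹ := inv_anti₀ (by positivity) hsl
  have h5 : (2 / π * δ)⁻¹ = π / (2 * δ) := by field_simp
  rw [le_div_iff₀ (by positivity)]
  have h6 : |R| * ‖∫ θ in δ..(π/2), ph R θ‖ ≤ π / δ := by
    have : 2 * (π / (2 * δ)) = π / δ := by field_simp
    linarith
  rw [le_div_iff₀ hδ] at h6
  linarith

lemma vdc2 (R : ℝ) (hR : 1 ≤ |R|) :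
    ‖∫ θ in (0:ℝ)..(π/2), ph R θ‖ ≤ (1 + π) / √|R| := by
  have hs : 1 ≤ √|R| := by rw [Real.one_le_sqrt]; exact hR
  set s := √|R| with hsdef
  have hss : s * s = |R| := Real.mul_self_sqrt (abs_nonneg R)
  have hs0 : 0 < s := by linarith
  have h1 : s⁻¹ ≤ π / 2 := by
    have := inv_le_one_of_one_le₀ hs
    linarith [Real.pi_gt_three]
  have hR0 : R ≠ 0 := by intro h; simp [h] at hR; linarith
  have hi : ∀ a b, IntervalIntegrable (ph R) volume a b := fun a b =>
    (ph_cont R).intervalIntegrable a b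
  rw [← intervalIntegral.integral_add_adjacent_intervals (hi 0 s⁻¹) (hi _ _)]
  refine (norm_add_le _ _).trans ?_
  have h2 := vdc1 R s⁻¹ hR0 (by positivity) h1
  have h3 : ‖∫ θ in (0:ℝ)..s⁻¹, ph R θ‖ ≤ 1 * |s⁻¹ - 0| :=
    intervalIntegral.norm_integral_le_of_norm_le_const fun θ _ => (ph_norm R θ).le
  rw [sub_zero, abs_of_pos (by positivity), one_mul] at h3
  have h4 : π / (|R| * s⁻¹) = π / s := by
    rw [← hss]; field_simp
  rw [h4] at h2
  rw [add_div, one_div]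
  linarith

lemma vdc3 (R : ℝ) (hR : 1 ≤ |R|) :
    ‖∫ θ in (0:ℝ)..(2*π), ph R θ‖ ≤ 4 * ((1 + π) / √|R|) := by
  have hi : ∀ a b, IntervalIntegrable (ph R) volume a b := fun a b =>
    (ph_cont R).intervalIntegrable a b
  have hA : ‖∫ θ in (0:ℝ)..π, ph R θ‖ ≤ 2 * ((1 + π) / √|R|) := by
    rw [← intervalIntegral.integral_add_adjacent_intervals (hi 0 (π/2)) (hi _ _)]
    refine (norm_add_le _ _).trans ?_
    have h1 := vdc2 R hR
    have h2 := vdc2 (-R) (by simpa using hR)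
    have h3 : ∫ θ in (π/2)..π, ph R θ = ∫ θ in (0:ℝ)..(π/2), ph (-R) θ := by
      have := intervalIntegral.integral_comp_sub_left (a := 0) (b := π/2) (ph R) π
      rw [sub_zero, show π - π/2 = π/2 by ring] at this
      rw [← this]
      congr 1; ext θ
      simp [ph, Real.cos_pi_sub]
    rw [h3]
    rw [abs_neg] at h2
    linarith
  have hB : ∫ θ in π..(2*π), ph R θ = ∫ θ in (0:ℝ)..π, ph R θ := by
    have := intervalIntegral.integral_comp_sub_left (a := 0) (b := π) (ph R) (2*π)
    rw [sub_zero, show 2*π - π = π by ring] at this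
    rw [← this]
    congr 1; ext θ
    simp [ph, Real.cos_two_pi_sub]
  rw [← intervalIntegral.integral_add_adjacent_intervals (hi 0 π) (hi _ _), hB]
  refine (norm_add_le _ _).trans ?_
  linarith

lemma vdc4 (R : ℝ) (hR : 0 ≤ R) :
    ‖∫ θ in (0:ℝ)..(2*π), ph R θ‖ ≤ 32 * (1 + R) ^ (-(1/2) : ℝ) := by
  have hp : (1 + R) ^ (-(1/2) : ℝ) = (√(1+R))⁻¹ := by
    rw [Real.rpow_neg (by linarith), Real.sqrt_eq_rpow]
  rw [hp, ← div_eq_mul_inv]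
  have h2 : √2 ≤ 3/2 := by
    rw [Real.sqrt_le_left (by norm_num)]; norm_num
  have hpi := Real.pi_lt_d2
  have hpi0 := Real.pi_pos
  have hs0 : 0 < √(1+R) := Real.sqrt_pos.mpr (by linarith)
  rw [le_div_iff₀ hs0]
  rcases le_total 1 R with h | h
  · have h1 := vdc3 R (by rwa [abs_of_nonneg hR])
    rw [abs_of_nonneg hR] at h1
    have hr0 : 0 < √R := Real.sqrt_pos.mpr (by linarith)
    have h3 : √(1+R) ≤ √2 * √R := by
      rw [← Real.sqrt_mul (by norm_num)]
      exact Real.sqrt_le_sqrt (by linarith)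
    have h4 : √(1+R) ≤ 3/2 * √R := h3.trans (by gcongr)
    calc _ ≤ 4 * ((1 + π) / √R) * (3/2 * √R) := by gcongr
      _ = 6 * (1 + π) := by field_simp; ring
      _ ≤ 32 := by linarith
  · have h3 : ‖∫ θ in (0:ℝ)..(2*π), ph R θ‖ ≤ 1 * |2*π - 0| :=
      intervalIntegral.norm_integral_le_of_norm_le_const fun θ _ => (ph_norm R θ).le
    rw [sub_zero, abs_of_pos (by positivity), one_mul] at h3
    have h4 : √(1+R) ≤ 3/2 := (Real.sqrt_le_sqrt (by linarith)).trans h2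
    calc _ ≤ 2 * π * (3/2) := by gcongr
      _ ≤ 32 := by linarith

/-- Parametrization of the circle. -/
def cf (θ : ℝ) : E2 := !₂[Real.cos θ, Real.sin θ]

lemma cf_lip : LipschitzWith 1 cf := by
  apply LipschitzWith.of_dist_le_mul
  intro a b
  rw [NNReal.coe_one, one_mul, EuclideanSpace.dist_eq, Real.dist_eq]
  apply Real.sqrt_le_iff.mpr ⟨abs_nonneg _, ?_⟩
  simp only [cf, Fin.sum_univ_two, Real.dist_eq, sq_abs]
  have h1 := Real.one_sub_sq_div_two_le_cos (x := a - b)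
  rw [Real.cos_sub] at h1
  have h2 := Real.sin_sq_add_cos_sq a
  have h3 := Real.sin_sq_add_cos_sq b
  simp
  nlinarith

/-- The parametrized arc length. -/
def rho : Measure E2 := (volume.restrict (Set.Ioc (0:ℝ) (2*π))).map cf

instance : IsFiniteMeasure rho := by
  unfold rho; infer_instance

lemma cf_meas : Measurable cf := cf_lip.continuous.measurable

lemma sm_le : sm ≤ rho := by
  rw [Measure.le_iff]
  intro s hs
  rw [sm, rho, Measure.restrict_apply hs, Measure.map_apply cf_meas hs,
    Measure.restrict_apply (cf_meas hs)]
  have hsub : s ∩ Metric.sphere (0:E2) 1 ⊆ cf '' (cf ⁻¹' s ∩ Set.Ioc (0:ℝ) (2*π)) := by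
    rintro x ⟨hxs, hx⟩
    rw [mem_sphere_zero_iff_norm] at hx
    have hx2 : x 0 ^ 2 + x 1 ^ 2 = 1 := by
      have := EuclideanSpace.norm_sq_eq x
      rw [hx, Fin.sum_univ_two] at this
      simpa using this.symm
    obtain ⟨θ, hθ⟩ : ∃ θ, cf θ = x := by
      have hn : ‖(⟨x 0, x 1⟩ : ℂ)‖ = 1 := by
        rw [Complex.norm_def, Complex.normSq_mk, Real.sqrt_eq_one]; linarith
      have hne : (⟨x 0, x 1⟩ : ℂ) ≠ 0 := by
        intro h; rw [h] at hn; simp at hn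
      refine ⟨Complex.arg ⟨x 0, x 1⟩, ?_⟩
      ext i
      fin_cases i
      · simp [cf, Complex.cos_arg hne, hn]
      · simp [cf, Complex.sin_arg, hn]
    have hper : Function.Periodic cf (2*π) := by
      intro t; simp [cf]
    obtain ⟨y, hy, hy'⟩ := hper.exists_mem_Ioc (by positivity) θ 0
    rw [zero_add] at hy
    refine ⟨y, ⟨?_, hy⟩, ?_⟩
    · simp [← hy', hθ, hxs]
    · rw [← hy', hθ]
  refine (measure_mono hsub).trans ?_
  refine (cf_lip.hausdorffMeasure_image_le zero_le_one _).trans ?_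
  rw [hausdorffMeasure_real]
  simp

lemma charFun_rho (t : E2) : ‖charFun rho t‖ ≤ 32 * (1 + ‖t‖) ^ (-(1/2) : ℝ) := by
  obtain ⟨φ, h0, h1⟩ : ∃ φ, t 0 = ‖t‖ * Real.cos φ ∧ t 1 = ‖t‖ * Real.sin φ := by
    have hn : ‖(⟨t 0, t 1⟩ : ℂ)‖ = ‖t‖ := by
      rw [Complex.norm_def, Complex.normSq_mk, EuclideanSpace.norm_eq, Fin.sum_univ_two]
      simp [sq]
    refine ⟨Complex.arg ⟨t 0, t 1⟩, ?_, ?_⟩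
    · rw [← hn, Complex.norm_mul_cos_arg]
    · rw [← hn, Complex.norm_mul_sin_arg]
  have key : charFun rho t = ∫ θ in (0:ℝ)..(2*π), ph ‖t‖ θ := by
    rw [charFun_apply, rho, integral_map cf_meas.aemeasurable (by fun_prop),
      ← intervalIntegral.integral_of_le (by positivity)]
    have hper : Function.Periodic (ph ‖t‖) (2*π) := by
      intro t; simp [ph]
    have := hper.intervalIntegral_add_eq 0 (-φ)
    rw [zero_add] at this
    rw [this]
    have h2 := intervalIntegral.integral_comp_sub_right (a := 0) (b := 2*π) (ph ‖t‖) φ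
    rw [zero_sub, show 2*π - φ = -φ + 2*π by ring] at h2
    rw [← h2]
    congr 1; ext θ
    simp only [ph]
    congr 3
    rw [Real.cos_sub, PiLp.inner_apply, Fin.sum_univ_two, h0, h1]
    simp [cf]
    ring
  rw [key]
  exact vdc4 _ (norm_nonneg t)

/-- five-fold convolution of the parametrized arc length. -/
def rho5 : Measure E2 := mconv rho (mconv rho (mconv rho (mconv rho rho)))

lemma mconv_eq (μ ν : Measure E2) : mconv μ ν = μ.conv ν := rfl

instance (μ ν : Measure E2) [IsFiniteMeasure μ] [IsFiniteMeasure ν] :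
    IsFiniteMeasure (mconv μ ν) := by
  unfold mconv; infer_instance

instance : IsFiniteMeasure rho5 := by unfold rho5; infer_instance

instance : IsFiniteMeasure sm := isFiniteMeasure_of_le rho sm_le

lemma mconv_mono {μ ν μ' ν' : Measure E2} [SFinite ν] [SFinite ν'] (h1 : μ ≤ μ') (h2 : ν ≤ ν') :
    mconv μ ν ≤ mconv μ' ν' :=
  Measure.map_mono (Measure.prod_mono h1 h2) (by fun_prop)

lemma sm5_le : mconv sm (mconv sm (mconv sm (mconv sm sm))) ≤ rho5 :=
  mconv_mono sm_le (mconv_mono sm_le (mconv_mono sm_le (mconv_mono sm_le sm_le)))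

lemma charFun_rho5 (t : E2) : ‖charFun rho5 t‖ ≤ 32^5 * (1 + ‖t‖) ^ (-(5/2) : ℝ) := by
  have h : charFun rho5 t = charFun rho t ^ 5 := by
    unfold rho5
    simp only [mconv_eq]
    rw [charFun_conv, charFun_conv, charFun_conv, charFun_conv]
    ring
  rw [h, norm_pow]
  calc _ ≤ (32 * (1 + ‖t‖) ^ (-(1/2) : ℝ)) ^ 5 := by gcongr; exact charFun_rho t
    _ = _ := by
      rw [mul_pow, ← Real.rpow_natCast, ← Real.rpow_natCast, ← Real.rpow_mul (by positivity)]
      norm_num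

lemma charFun_rho5_int : Integrable (fun t => ‖charFun rho5 t‖) (volume : Measure E2) := by
  have h : Integrable (fun t : E2 => 32^5 * (1 + ‖t‖) ^ (-(5/2) : ℝ)) volume := by
    apply Integrable.const_mul
    apply integrable_one_add_norm
    simp; norm_num
  refine h.mono' (measurable_charFun.norm.aestronglyMeasurable) ?_
  exact Filter.Eventually.of_forall fun t => by simpa using charFun_rho5 t

/-- Gaussian regularization bound. -/
lemma gauss_bound (μ : Measure E2) [IsFiniteMeasure μ]
    (hμ : Integrable (fun t => ‖charFun μ t‖) (volume : Measure E2)) (x : E2) (r : ℝ) (hr : 0 < r) :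
    π / r^2 * ∫ y, Real.exp (-(‖y - x‖^2 / (4 * r^2))) ∂μ ≤ ∫ t, ‖charFun μ t‖ := by
  let F : E2 → E2 → ℂ := fun y ξ =>
    Complex.exp (-((r^2 : ℝ) : ℂ) * ‖ξ‖^2 + Complex.I * (inner ℝ (y - x) ξ : ℝ))
  have hbre : 0 < (((r^2 : ℝ) : ℂ)).re := by rw [Complex.ofReal_re]; positivity
  have hFn : ∀ y ξ, ‖F y ξ‖ = Real.exp (-(r^2) * ‖ξ‖^2) := by
    intro y ξ
    simp only [F, Complex.norm_exp]
    congr 1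
    simp [← Complex.ofReal_pow]
  have hF1 : ∀ y, ∫ ξ, F y ξ = ((π / r^2 * Real.exp (-(‖y - x‖^2 / (4 * r^2))) : ℝ) : ℂ) := by
    intro y
    have := GaussianFourier.integral_cexp_neg_mul_sq_norm_add hbre Complex.I (y - x)
    simp only [F]
    rw [this]
    simp
    left
    congr 1
    ring
  have hF2 : ∀ ξ, ∫ y, F y ξ ∂μ =
      Complex.exp (-((r^2 : ℝ) : ℂ) * ‖ξ‖^2 - Complex.I * (inner ℝ x ξ : ℝ)) * charFun μ ξ := by
    intro ξ
    rw [charFun_apply, ← integral_const_mul]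
    congr 1; ext y
    simp only [F]
    rw [← Complex.exp_add, inner_sub_left]
    congr 1
    push_cast
    ring
  have hint : Integrable (Function.uncurry F) (μ.prod volume) := by
    have hg : Integrable (fun ξ : E2 => Real.exp (-(r^2) * ‖ξ‖^2)) volume := by
      have := (GaussianFourier.integrable_cexp_neg_mul_sq_norm_add hbre 0 (0:E2)).norm
      refine this.congr (Filter.Eventually.of_forall fun ξ => ?_)
      simp [Complex.norm_exp, ← Complex.ofReal_pow]
    have hg2 := hg.comp_snd μ
    refine hg2.mono' ?_ ?_
    · apply Continuous.aestronglyMeasurable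
      simp only [F, Function.uncurry_def]
      fun_prop
    · exact Filter.Eventually.of_forall fun p => (hFn p.1 p.2).le
  have hswap := integral_integral_swap hint
  simp only [hF1, hF2] at hswap
  rw [integral_complex_ofReal, integral_const_mul] at hswap
  calc π / r^2 * ∫ y, Real.exp (-(‖y - x‖^2 / (4 * r^2))) ∂μ
      ≤ ‖((π / r^2 * ∫ y, Real.exp (-(‖y - x‖^2 / (4 * r^2))) ∂μ : ℝ) : ℂ)‖ := by
        rw [Complex.norm_real]; exact le_abs_self _
    _ ≤ _ := by
      rw [hswap]
      apply norm_integral_le_of_norm_le hμ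
      refine Filter.Eventually.of_forall fun ξ => ?_
      rw [norm_mul]
      apply mul_le_of_le_one_left (norm_nonneg _)
      rw [Complex.norm_exp, Real.exp_le_one_iff]
      simp [← Complex.ofReal_pow]
      positivity

lemma ball_bound (μ : Measure E2) [IsFiniteMeasure μ]
    (hμ : Integrable (fun t => ‖charFun μ t‖) (volume : Measure E2)) (x : E2) (r : ℝ) (hr : 0 < r) :
    μ (Metric.closedBall x r) ≤
      ENNReal.ofReal (Real.exp 1 * (∫ t, ‖charFun μ t‖) + 1) * volume (Metric.closedBall x r) := by
  have hg := gauss_bound μ hμ x r hr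
  set M := ∫ t, ‖charFun μ t‖
  have hM : 0 ≤ M := integral_nonneg fun _ => norm_nonneg _
  have hint : Integrable (fun y => Real.exp (-(‖y - x‖^2 / (4 * r^2)))) μ := by
    refine (integrable_const (1:ℝ)).mono' ?_ ?_
    · apply Continuous.aestronglyMeasurable; fun_prop
    · refine Filter.Eventually.of_forall fun y => ?_
      rw [Real.norm_eq_abs, abs_of_pos (Real.exp_pos _), Real.exp_le_one_iff, neg_nonpos]
      positivity
  have h1 : Real.exp (-1) * μ.real (Metric.closedBall x r) ≤
      ∫ y, Real.exp (-(‖y - x‖^2 / (4 * r^2))) ∂μ := by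
    calc Real.exp (-1) * μ.real (Metric.closedBall x r)
        = ∫ y in Metric.closedBall x r, Real.exp (-1) ∂μ := by
          simp [mul_comm]
      _ ≤ ∫ y in Metric.closedBall x r, Real.exp (-(‖y - x‖^2 / (4 * r^2))) ∂μ := by
          apply setIntegral_mono_on (integrable_const _) hint.integrableOn
            Metric.isClosed_closedBall.measurableSet
          intro y hy
          rw [Metric.mem_closedBall, dist_eq_norm] at hy
          rw [Real.exp_le_exp, neg_le_neg_iff, div_le_one (by positivity)]
          have : ‖y - x‖^2 ≤ r^2 := by gcongr
          nlinarith
      _ ≤ _ := setIntegral_le_integral hint (Filter.Eventually.of_forall fun y => (Real.exp_pos _).le)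
  have h2 : μ.real (Metric.closedBall x r) ≤ Real.exp 1 * M * (r^2 * π) := by
    have hpi := Real.pi_gt_three
    have h3 : π / r^2 * (Real.exp (-1) * μ.real (Metric.closedBall x r)) ≤ M :=
      le_trans (by gcongr) hg
    have h4 : μ.real (Metric.closedBall x r) * π ≤ Real.exp 1 * M * r^2 := by
      rw [Real.exp_neg] at h3
      have : π / r^2 * ((Real.exp 1)⁻¹ * μ.real (Metric.closedBall x r)) =
          (μ.real (Metric.closedBall x r) * π) / (Real.exp 1 * r^2) := by
        field_simp
      rw [this, div_le_iff₀ (by positivity)] at h3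
      linarith
    have h5 : 0 ≤ μ.real (Metric.closedBall x r) := measureReal_nonneg
    have h6 : 0 ≤ Real.exp 1 * M * r^2 := by positivity
    nlinarith
  rw [EuclideanSpace.volume_closedBall_fin_two, ← ENNReal.ofReal_toReal (measure_ne_top μ _),
    show (μ (Metric.closedBall x r)).toReal = μ.real (Metric.closedBall x r) from rfl]
  have hv : ENNReal.ofReal r ^ 2 * ENNReal.ofReal π = ENNReal.ofReal (r^2 * π) := by
    rw [ENNReal.ofReal_mul (by positivity), ENNReal.ofReal_pow hr.le]
  rw [hv, ← ENNReal.ofReal_mul (by positivity)]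
  apply ENNReal.ofReal_le_ofReal
  refine h2.trans ?_
  gcongr
  linarith

lemma le_of_ball (μ : Measure E2) (K : ℝ≥0∞) (hK : K ≠ ⊤)
    (h : ∀ x r, 0 < r → μ (Metric.closedBall x r) ≤ K * volume (Metric.closedBall x r)) :
    μ ≤ K • volume := by
  rw [Measure.le_iff]
  intro s _
  have hε : ∀ ε : ℝ≥0∞, ε ≠ 0 → μ s ≤ K * (volume s + ε) := by
    intro ε hε
    obtain ⟨t, r, htc, hts, hr, hcov, hsum⟩ :=
      Besicovitch.exists_closedBall_covering_tsum_measure_le (volume : Measure E2) hε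
        (fun _ => Set.Ioi 0) s (by
          intro x _ δ hδ
          exact ⟨δ/2, by simp [hδ], by simp [hδ]⟩)
    have : Countable t := htc
    calc μ s ≤ μ (⋃ x ∈ t, Metric.closedBall x (r x)) := measure_mono hcov
      _ ≤ ∑' x : t, μ (Metric.closedBall x (r x)) := measure_biUnion_le μ htc _
      _ ≤ ∑' x : t, K * volume (Metric.closedBall (x : E2) (r x)) :=
          ENNReal.tsum_le_tsum fun x => h _ _ (hr x x.2)
      _ = K * ∑' x : t, volume (Metric.closedBall (x : E2) (r x)) := ENNReal.tsum_mul_left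
      _ ≤ _ := by gcongr
  rw [Measure.smul_apply, smul_eq_mul]
  have hlim : Filter.Tendsto (fun ε : ℝ≥0∞ => K * (volume s + ε)) (nhdsWithin 0 {0}ᶜ)
      (nhds (K * (volume s + 0))) := by
    apply Filter.Tendsto.mono_left _ nhdsWithin_le_nhds
    apply ENNReal.Tendsto.const_mul _ (Or.inr hK)
    exact (continuous_const.add continuous_id).tendsto _
  rw [add_zero] at hlim
  exact ge_of_tendsto hlim (Filter.eventually_of_mem self_mem_nhdsWithin fun ε hx => hε ε hx)

/-- The five-fold convolution `σ ∗ σ ∗ σ ∗ σ ∗ σ` is absolutely continuous with a density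
which is essentially bounded on the ball `{|x| ≤ 5}`. -/
theorem fivefold_conv_bounded_density :
    ∃ (C : ℝ), 0 < C ∧ ∃ g : E2 → ℝ≥0∞,
      mconv sm (mconv sm (mconv sm (mconv sm sm))) = volume.withDensity g ∧
      ∀ᵐ x ∂(volume : Measure E2), ‖x‖ ≤ 5 → g x ≤ ENNReal.ofReal C := by
  have hM : 0 ≤ ∫ t, ‖charFun rho5 t‖ := integral_nonneg fun _ => norm_nonneg _
  refine ⟨Real.exp 1 * (∫ t, ‖charFun rho5 t‖) + 1, by positivity, ?_⟩
  set C := Real.exp 1 * (∫ t, ‖charFun rho5 t‖) + 1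
  set μ := mconv sm (mconv sm (mconv sm (mconv sm sm)))
  have hle : μ ≤ ENNReal.ofReal C • volume :=
    sm5_le.trans (le_of_ball rho5 _ ENNReal.ofReal_ne_top
      (fun x r hr => ball_bound rho5 charFun_rho5_int x r hr))
  have hac : μ ≪ volume :=
    (Measure.absolutelyContinuous_of_le hle).trans (Measure.smul_absolutelyContinuous)
  refine ⟨μ.rnDeriv volume, (Measure.withDensity_rnDeriv_eq _ _ hac).symm, ?_⟩
  have hae : μ.rnDeriv volume ≤ᵐ[volume] fun _ => ENNReal.ofReal C := by
    apply ae_le_of_forall_setLIntegral_le_of_sigmaFinite (Measure.measurable_rnDeriv _ _)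
    intro s hs _
    rw [Measure.setLIntegral_rnDeriv hac, setLIntegral_const]
    exact hle s
  filter_upwards [hae] with x hx _
  exact hx
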